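/- Let d ≥ 2 and let E := Σ_{i=1}^{d-1} i·E_{i,i+1} and H := Σ_{i=1}^{d} (d+1−2i)·E_{i,i} be d×d complex matrices. Then the d−1 matrices W_k := H^k·(HE − EH)·H^{d−2−k}, for k = 0, 1, …, d−2, are linearly independent over ℂ in the space of d×d matrices. -/

import Mathlib

open Matrix

/-- `E = ∑_{i=1}^{d-1} i · E_{i,i+1}` (1-based indices), written entrywise with
0-based indices: the `(a, a+1)` entry is `a+1`. -/
noncomputable def matE (d : ℕ) : Matrix (Fin d) (Fin d) ℂ :=
  Matrix.of fun a b => if (b : ℕ) = (a : ℕ) + 1 then (((a : ℕ) + 1 : ℕ) : ℂ) else 0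

/-- `F = ∑_{i=1}^{d-1} (d-i) · E_{i+1,i}`: the `(b+1, b)` entry is `d - (b+1)`. -/
noncomputable def matF (d : ℕ) : Matrix (Fin d) (Fin d) ℂ :=
  Matrix.of fun a b => if (a : ℕ) = (b : ℕ) + 1 then ((d : ℂ) - (((b : ℕ) + 1 : ℕ) : ℂ)) else 0

/-- `H = ∑_{i=1}^{d} (d+1-2i) · E_{i,i}`: the `(a, a)` entry is `d + 1 - 2(a+1)`. -/
noncomputable def matH (d : ℕ) : Matrix (Fin d) (Fin d) ℂ :=
  Matrix.of fun a b => if a = b then ((d : ℂ) + 1 - 2 * (((a : ℕ) + 1 : ℕ) : ℂ)) else 0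


/-- The `a`-th diagonal entry `d + 1 - 2(a + 1)` of `matH d`, for any natural number `a`. -/
noncomputable def weightH (d a : ℕ) : ℂ :=
  (d : ℂ) + 1 - 2 * ((a + 1 : ℕ) : ℂ)

lemma matH_eq_diagonal (d : ℕ) : matH d = diagonal fun a : Fin d => weightH d a := by
  ext a b
  simp [matH, weightH, diagonal_apply]

lemma weightH_succ (d a : ℕ) : weightH d (a + 1) = weightH d a - 2 := by
  simp only [weightH]
  push_cast
  ring

/-- The superdiagonal entries of `Hᵐ(HE - EH)Hⁿ`. -/
lemma matH_pow_mul_commutator_mul_matH_pow_apply {d : ℕ} (m n : ℕ) {a b : Fin d}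
    (hab : (b : ℕ) = a + 1) :
    (matH d ^ m * (matH d * matE d - matE d * matH d) * matH d ^ n) a b =
      2 * ((a + 1 : ℕ) : ℂ) * (weightH d a ^ m * weightH d (a + 1) ^ n) := by
  have hE : matE d a b = ((a + 1 : ℕ) : ℂ) := by simp [matE, hab]
  rw [matH_eq_diagonal, diagonal_pow, diagonal_pow, mul_diagonal, diagonal_mul, Matrix.sub_apply,
    diagonal_mul, mul_diagonal, hE]
  simp only [Pi.pow_apply, hab, weightH_succ]
  ring

/-- The points `(λ_a : λ_{a+1})` built from consecutive weights are pairwise distinct. -/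
lemma det_projVandermonde_weightH_ne_zero (d n : ℕ) :
    (projVandermonde (fun a : Fin n => weightH d a) fun a => weightH d (a + 1)).det ≠ 0 := by
  rw [det_projVandermonde]
  refine Finset.prod_ne_zero_iff.2 fun i _ => Finset.prod_ne_zero_iff.2 fun j hj => ?_
  have hne : ((j : ℕ) : ℂ) - ((i : ℕ) : ℂ) ≠ 0 :=
    sub_ne_zero.2 <| Nat.cast_injective.ne (Fin.lt_def.1 (Finset.mem_Ioi.1 hj)).ne'
  have hdet : weightH d j * weightH d (i + 1) - weightH d i * weightH d (j + 1) =
      4 * (((j : ℕ) : ℂ) - ((i : ℕ) : ℂ)) := by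
    simp only [weightH]
    push_cast
    ring
  rw [hdet]
  exact mul_ne_zero (by norm_num) hne

/-- For `d ≥ 2`, the `d-1` matrices `W_k = Hᵏ·(HE - EH)·H^{d-2-k}`, `k = 0, …, d-2`
(the evaluations at `(H, E)` of the words `w_k = x₁ᵏ[x₁,x₂]x₁^{d-2-k}`), are
linearly independent over `ℂ` in the space of `d×d` matrices. -/
theorem stmt18 (d : ℕ) (hd : 2 ≤ d) :
    LinearIndependent ℂ (fun k : Fin (d - 1) =>
      (matH d) ^ (k : ℕ) * (matH d * matE d - matE d * matH d) *
        (matH d) ^ (d - 2 - (k : ℕ))) := by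
  rw [Fintype.linearIndependent_iff]
  intro c hc
  refine congrFun (eq_zero_of_mulVec_eq_zero
    (det_projVandermonde_weightH_ne_zero d (d - 1)) (funext fun a => ?_))
  have ha : (a : ℕ) + 1 < d := by omega
  have hentry := congrFun (congrFun hc ⟨a, by omega⟩) ⟨a + 1, ha⟩
  simp only [Matrix.sum_apply, Matrix.smul_apply, smul_eq_mul, Matrix.zero_apply,
    matH_pow_mul_commutator_mul_matH_pow_apply _ _
      (show ((⟨a + 1, ha⟩ : Fin d) : ℕ) = (⟨a, by omega⟩ : Fin d) + 1 from rfl)] at hentry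
  have hscale : (2 * ((a + 1 : ℕ) : ℂ)) ≠ 0 :=
    mul_ne_zero two_ne_zero (Nat.cast_ne_zero.2 (Nat.succ_ne_zero _))
  refine (mul_eq_zero.1 (Eq.trans ?_ hentry)).resolve_left hscale
  rw [mulVec, dotProduct, Finset.mul_sum]
  refine Finset.sum_congr rfl fun k _ => ?_
  have hrev : (k.rev : ℕ) = d - 2 - k := by rw [Fin.val_rev]; omega
  rw [projVandermonde_apply, hrev]
  ring
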